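/- Let d₁ ≥ 1. There is a constant C > 0 such that for all k ∈ ℕ, ∫_0^∞ |𝓛_k^{d₁−1}(τ)| τ^{−1/2} dτ ≤ C. -/

import Mathlib

open MeasureTheory
open scoped ENNReal

noncomputable section

/-- Laguerre polynomial of type `δ` and degree `k`. -/
def laguerreL (k : ℕ) (δ : ℝ) (τ : ℝ) : ℝ :=
  (1 / (Nat.factorial k : ℝ)) * Real.exp τ * τ ^ (-δ) *
    iteratedDeriv k (fun s : ℝ => Real.exp (-s) * s ^ ((k : ℝ) + δ)) τ

/-- normalized Laguerre function 𝓛_k^δ -/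
def laguerreNorm (k : ℕ) (δ : ℝ) (τ : ℝ) : ℝ :=
  Real.sqrt (Real.Gamma ((k : ℝ) + 1) / Real.Gamma ((k : ℝ) + δ + 1)) *
    Real.exp (-τ / 2) * τ ^ (δ / 2) * laguerreL k δ τ

end
open Polynomial in
/-- The rising factorial `t (t + 1) ⋯ (t + n - 1)` divided by `n!`. -/
noncomputable def risingBinom (t : ℝ) (n : ℕ) : ℝ := (ascPochhammer ℝ n).eval t / n.factorial

lemma risingBinom_zero (t : ℝ) : risingBinom t 0 = 1 := by simp [risingBinom]

lemma risingBinom_succ (t : ℝ) (n : ℕ) :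
    ((n : ℝ) + 1) * risingBinom t (n + 1) = (t + n) * risingBinom t n := by
  rw [risingBinom, risingBinom, ascPochhammer_succ_eval, Nat.factorial_succ]
  have : (n.factorial : ℝ) ≠ 0 := by positivity
  push_cast
  field_simp

lemma risingBinom_nonneg {t : ℝ} (ht : 0 < t) (n : ℕ) : 0 ≤ risingBinom t n :=
  div_nonneg (ascPochhammer_pos n t ht).le (by positivity)

/-- The Chu–Vandermonde identity. -/
lemma sum_risingBinom_mul (a b : ℝ) (n : ℕ) :
    ∑ p ∈ Finset.HasAntidiagonal.antidiagonal n, risingBinom a p.1 * risingBinom b p.2 =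
      risingBinom (a + b) n := by
  induction n with
  | zero => simp [risingBinom_zero]
  | succ n ih =>
    have key : ((n : ℝ) + 1) * ∑ p ∈ Finset.HasAntidiagonal.antidiagonal (n + 1),
        risingBinom a p.1 * risingBinom b p.2 = (a + b + n) * risingBinom (a + b) n := by
      have h1 : ((n : ℝ) + 1) * ∑ p ∈ Finset.HasAntidiagonal.antidiagonal (n + 1),
          risingBinom a p.1 * risingBinom b p.2 =
          ∑ p ∈ Finset.HasAntidiagonal.antidiagonal (n + 1),
            (p.1 * risingBinom a p.1) * risingBinom b p.2 +
          ∑ p ∈ Finset.HasAntidiagonal.antidiagonal (n + 1),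
            risingBinom a p.1 * (p.2 * risingBinom b p.2) := by
        rw [Finset.mul_sum, ← Finset.sum_add_distrib]
        refine Finset.sum_congr rfl fun p hp => ?_
        have : (p.1 : ℝ) + p.2 = n + 1 := by
          exact_mod_cast Finset.HasAntidiagonal.mem_antidiagonal.1 hp
        rw [← this]; ring
      rw [h1, Finset.Nat.sum_antidiagonal_succ, Finset.Nat.sum_antidiagonal_succ', ← ih,
        Finset.mul_sum]
      simp only [Nat.cast_zero, zero_mul, zero_add, mul_zero]
      rw [← Finset.sum_add_distrib]
      refine Finset.sum_congr rfl fun p hp => ?_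
      have : (p.1 : ℝ) + p.2 = n := by exact_mod_cast Finset.HasAntidiagonal.mem_antidiagonal.1 hp
      push_cast
      rw [risingBinom_succ, risingBinom_succ, ← this]; ring
    rw [← risingBinom_succ] at key
    exact mul_left_cancel₀ (by positivity) key

lemma risingBinom_le {t : ℝ} (ht0 : 0 < t) (ht1 : t < 1) (n : ℕ) :
    risingBinom t n ≤ ((n : ℝ) + 1) ^ (t - 1) := by
  induction n with
  | zero => simp [risingBinom_zero]
  | succ n ih =>
    have hn : (0 : ℝ) < n + 1 := by positivity
    have hb : ((n : ℝ) + t) * ((n : ℝ) + 1) ^ (t - 1) ≤ (n + 1) * ((n : ℝ) + 1 + 1) ^ (t - 1) := by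
      have h1 := rpow_one_add_le_one_add_mul_self (s := 1 / ((n : ℝ) + 1)) (p := 1 - t)
        (by have : 0 ≤ 1 / ((n : ℝ) + 1) := by positivity
            linarith) (by linarith) (by linarith)
      have hw : 0 < (1 + 1 / ((n : ℝ) + 1)) ^ (1 - t) := by positivity
      have h2 : ((n : ℝ) + 1 + 1) ^ (t - 1) =
          ((n : ℝ) + 1) ^ (t - 1) * ((1 + 1 / ((n : ℝ) + 1)) ^ (1 - t))⁻¹ := by
        rw [← Real.rpow_neg (by positivity), neg_sub, ← Real.mul_rpow hn.le (by positivity)]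
        congr 1
        field_simp
      rw [h2, mul_left_comm, mul_comm]
      refine mul_le_mul_of_nonneg_left ?_ (by positivity)
      rw [← div_eq_mul_inv, le_div_iff₀ hw]
      calc ((n : ℝ) + t) * (1 + 1 / ((n : ℝ) + 1)) ^ (1 - t)
          ≤ (n + t) * (1 + (1 - t) * (1 / (n + 1))) :=
            mul_le_mul_of_nonneg_left h1 (by positivity)
        _ = (n + 1) - (1 - t) ^ 2 / (n + 1) := by field_simp; ring
        _ ≤ n + 1 := by
          have : 0 ≤ (1 - t) ^ 2 / ((n : ℝ) + 1) := by positivity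
          linarith
    have h2 := risingBinom_succ t n
    push_cast
    have h3 : ((n : ℝ) + 1) * risingBinom t (n + 1) ≤ (n + 1) * ((n : ℝ) + 1 + 1) ^ (t - 1) := by
      rw [h2, add_comm t]
      exact (mul_le_mul_of_nonneg_left ih (by positivity)).trans hb
    exact le_of_mul_le_mul_left h3 hn

lemma Gamma_add_nat {t : ℝ} (ht : 0 < t) (n : ℕ) :
    Real.Gamma (t + n) = Real.Gamma t * (ascPochhammer ℝ n).eval t := by
  induction n with
  | zero => simp
  | succ n ih =>
    push_cast
    rw [← add_assoc, Real.Gamma_add_one (by positivity), ih, ascPochhammer_succ_eval]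
    ring

open Polynomial in
/-- The linear functional `q ↦ ∫₀^∞ q(x) x^β e^{-x} dx` on polynomials. -/
noncomputable def gammaFunctional (β : ℝ) : ℝ[X] →ₗ[ℝ] ℝ :=
  Polynomial.lsum fun m => Real.Gamma (m + β + 1) • LinearMap.id

open Polynomial in
lemma gammaFunctional_monomial (β : ℝ) (m : ℕ) (a : ℝ) :
    gammaFunctional β (monomial m a) = a * Real.Gamma (m + β + 1) := by
  simp [gammaFunctional, Polynomial.lsum_apply, Polynomial.sum_monomial_index, mul_comm]

open Polynomial in
lemma integral_eval_mul {β : ℝ} (hβ : -1 < β) (q : ℝ[X]) :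
    IntegrableOn (fun x => q.eval x * (x ^ β * Real.exp (-x))) (Set.Ioi 0) ∧
      ∫ x in Set.Ioi 0, q.eval x * (x ^ β * Real.exp (-x)) = gammaFunctional β q := by
  induction q using Polynomial.induction_on' with
  | add p q hp hq =>
    simp only [eval_add, add_mul, map_add]
    exact ⟨hp.1.add hq.1, by rw [integral_add hp.1 hq.1, hp.2, hq.2]⟩
  | monomial m a =>
    have hpos : 0 < m + β + 1 := by have : (0 : ℝ) ≤ m := by positivity
                                    linarith
    have he : Set.EqOn (fun x => a * (Real.exp (-x) * x ^ (m + β + 1 - 1)))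
        (fun x => (monomial m a).eval x * (x ^ β * Real.exp (-x))) (Set.Ioi 0) := by
      intro x hx
      have hx : 0 < x := hx
      simp only [eval_monomial]
      rw [add_sub_cancel_right, Real.rpow_add hx, Real.rpow_natCast]
      ring
    refine ⟨IntegrableOn.congr_fun ((Real.GammaIntegral_convergent hpos).const_mul a) he
      measurableSet_Ioi, ?_⟩
    rw [← setIntegral_congr_fun measurableSet_Ioi he, integral_const_mul,
      ← Real.Gamma_eq_integral hpos, gammaFunctional_monomial]

open Polynomial in
/-- The Laguerre polynomial of type `β` and degree `k`, given by its coefficients. -/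
noncomputable def laguerrePoly (β : ℝ) (k : ℕ) : ℝ[X] :=
  ∑ i ∈ Finset.range (k + 1),
    monomial i ((-1) ^ i / i.factorial * risingBinom (β + i + 1) (k - i))

open Polynomial in
lemma gammaFunctional_X_pow_mul_laguerrePoly {β : ℝ} (hβ : -1 < β) (m j : ℕ) :
    gammaFunctional β (X ^ m * laguerrePoly β j) =
      Real.Gamma (j + β + 1) / j.factorial *
        ∑ i ∈ Finset.range (j + 1), (-1) ^ i * j.choose i *
          (ascPochhammer ℝ m).eval (β + 1 + i) := by
  rw [laguerrePoly, Finset.mul_sum, map_sum, Finset.mul_sum]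
  refine Finset.sum_congr rfl fun i hi => ?_
  have hij : i ≤ j := Nat.lt_succ_iff.1 (Finset.mem_range.1 hi)
  have hpos : 0 < β + i + 1 := by have : (0 : ℝ) ≤ i := by positivity
                                  linarith
  rw [X_pow_mul_monomial, gammaFunctional_monomial]
  have h1 := Gamma_add_nat hpos m
  have h2 := Gamma_add_nat hpos (j - i)
  rw [Nat.cast_sub hij] at h2
  have e1 : ((i + m : ℕ) : ℝ) + β + 1 = β + i + 1 + m := by push_cast; ring
  have e2 : (j : ℝ) + β + 1 = β + i + 1 + (j - i) := by ring
  have e3 : β + 1 + (i : ℝ) = β + i + 1 := by ring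
  rw [e1, e2, e3, h1, h2, risingBinom, Nat.cast_choose ℝ hij]
  have : (j.factorial : ℝ) ≠ 0 := by positivity
  have : (i.factorial : ℝ) ≠ 0 := by positivity
  have : ((j - i).factorial : ℝ) ≠ 0 := by positivity
  field_simp

open Polynomial in
lemma sum_neg_one_pow_mul_choose_mul_eval (q : ℝ[X]) (c : ℝ) (j : ℕ) :
    ∑ i ∈ Finset.range (j + 1), (-1) ^ i * j.choose i * q.eval (c + i) =
      (-1) ^ j * (fwdDiff 1)^[j] q.eval c := by
  rw [fwdDiff_iter_eq_sum_shift, Finset.mul_sum]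
  refine Finset.sum_congr rfl fun i hi => ?_
  have hij : i ≤ j := Nat.lt_succ_iff.1 (Finset.mem_range.1 hi)
  obtain ⟨l, rfl⟩ := Nat.exists_eq_add_of_le hij
  simp only [add_tsub_cancel_left, zsmul_eq_mul, nsmul_eq_mul]
  push_cast
  have : ((-1 : ℝ) ^ l) * (-1) ^ l = 1 := by rw [← mul_pow]; simp
  rw [mul_one, pow_add]
  linear_combination (-(-1) ^ i * ((i + l).choose i : ℝ) * q.eval (c + i)) * this

open Polynomial in
lemma gammaFunctional_X_pow_mul_laguerrePoly_of_lt {β : ℝ} (hβ : -1 < β) {m j : ℕ} (h : m < j) :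
    gammaFunctional β (X ^ m * laguerrePoly β j) = 0 := by
  rw [gammaFunctional_X_pow_mul_laguerrePoly hβ, sum_neg_one_pow_mul_choose_mul_eval,
    Polynomial.fwdDiff_iter_eq_zero_of_degree_lt (by rwa [ascPochhammer_natDegree])]
  simp

open Polynomial in
lemma gammaFunctional_X_pow_mul_laguerrePoly_self {β : ℝ} (hβ : -1 < β) (j : ℕ) :
    gammaFunctional β (X ^ j * laguerrePoly β j) = (-1) ^ j * Real.Gamma (j + β + 1) := by
  have h := Polynomial.fwdDiff_iter_degree_eq_factorial (ascPochhammer ℝ j)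
  rw [ascPochhammer_natDegree, (monic_ascPochhammer ℝ j).leadingCoeff] at h
  rw [gammaFunctional_X_pow_mul_laguerrePoly hβ, sum_neg_one_pow_mul_choose_mul_eval, h]
  have : (j.factorial : ℝ) ≠ 0 := by positivity
  simp
  field_simp

open Polynomial in
lemma gammaFunctional_laguerrePoly_mul_of_lt {β : ℝ} (hβ : -1 < β) {i j : ℕ} (h : i < j) :
    gammaFunctional β (laguerrePoly β i * laguerrePoly β j) = 0 := by
  conv_lhs => rw [laguerrePoly]
  rw [Finset.sum_mul, map_sum]
  refine Finset.sum_eq_zero fun m hm => ?_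
  rw [← C_mul_X_pow_eq_monomial, mul_assoc, ← smul_eq_C_mul, map_smul,
    gammaFunctional_X_pow_mul_laguerrePoly_of_lt hβ (by simp at hm; omega), smul_zero]

open Polynomial in
lemma gammaFunctional_laguerrePoly_mul_self {β : ℝ} (hβ : -1 < β) (j : ℕ) :
    gammaFunctional β (laguerrePoly β j * laguerrePoly β j) =
      Real.Gamma (j + β + 1) / j.factorial := by
  nth_rewrite 1 [laguerrePoly]
  rw [Finset.sum_mul, map_sum, Finset.sum_range_succ, Finset.sum_eq_zero, zero_add]
  · rw [← C_mul_X_pow_eq_monomial, mul_assoc, ← smul_eq_C_mul, map_smul,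
      gammaFunctional_X_pow_mul_laguerrePoly_self hβ, Nat.sub_self, risingBinom_zero, smul_eq_mul]
    have : ((-1 : ℝ) ^ j) * (-1) ^ j = 1 := by rw [← mul_pow]; simp
    linear_combination (Real.Gamma (j + β + 1) / j.factorial) * this
  · intro m hm
    rw [← C_mul_X_pow_eq_monomial, mul_assoc, ← smul_eq_C_mul, map_smul,
      gammaFunctional_X_pow_mul_laguerrePoly_of_lt hβ (Finset.mem_range.1 hm), smul_zero]

open Polynomial in
/-- The connection formula between Laguerre polynomials of different types. -/
lemma laguerrePoly_add (β s : ℝ) (k : ℕ) :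
    laguerrePoly (β + s) k =
      ∑ p ∈ Finset.HasAntidiagonal.antidiagonal k, risingBinom s p.1 • laguerrePoly β p.2 := by
  ext i
  simp only [laguerrePoly, finsetSum_coeff, coeff_smul, coeff_monomial, smul_eq_mul,
    Finset.sum_ite_eq', Finset.mem_range]
  split_ifs with h
  · obtain ⟨l, rfl⟩ := Nat.exists_eq_add_of_le (Nat.lt_succ_iff.1 h)
    rw [add_tsub_cancel_left, show β + s + i + 1 = s + (β + i + 1) by ring, ← sum_risingBinom_mul,
      Finset.mul_sum]
    refine Finset.sum_of_injOn (fun p => (p.1, p.2 + i)) ?_ ?_ ?_ ?_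
    · rintro ⟨a, b⟩ - ⟨c, d⟩ - h
      simpa using h
    · rintro ⟨a, b⟩ h
      simp only [Finset.mem_coe, Finset.HasAntidiagonal.mem_antidiagonal] at h ⊢
      omega
    · rintro ⟨a, b⟩ h h'
      rw [if_neg, mul_zero]
      intro hb
      refine h' ⟨(a, b - i), ?_, ?_⟩ <;> simp at h ⊢ <;> omega
    · rintro ⟨a, b⟩ -
      simp only [add_tsub_cancel_right]
      rw [if_pos (by omega)]
      ring
  · symm
    refine Finset.sum_eq_zero fun p hp => ?_
    have := Finset.HasAntidiagonal.mem_antidiagonal.1 hp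
    rw [if_neg (by omega), mul_zero]

lemma gammaFunctional_laguerrePoly_add_sq {β : ℝ} (hβ : -1 < β) (s : ℝ) (k : ℕ) :
    gammaFunctional β (laguerrePoly (β + s) k * laguerrePoly (β + s) k) =
      ∑ p ∈ Finset.HasAntidiagonal.antidiagonal k,
        risingBinom s p.1 ^ 2 * (Real.Gamma (p.2 + β + 1) / p.2.factorial) := by
  rw [laguerrePoly_add, Finset.sum_mul_sum, map_sum]
  refine Finset.sum_congr rfl fun p hp => ?_
  rw [map_sum, Finset.sum_eq_single p]
  · rw [smul_mul_smul_comm, map_smul, gammaFunctional_laguerrePoly_mul_self hβ, smul_eq_mul, sq]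
  · intro q hq hqp
    have hp' := Finset.HasAntidiagonal.mem_antidiagonal.1 hp
    have hq' := Finset.HasAntidiagonal.mem_antidiagonal.1 hq
    have hne : p.2 ≠ q.2 := fun h => hqp (Prod.ext (by omega) h.symm)
    rw [smul_mul_smul_comm, map_smul]
    rcases hne.lt_or_gt with h | h
    · rw [gammaFunctional_laguerrePoly_mul_of_lt hβ h, smul_zero]
    · rw [mul_comm (laguerrePoly β p.2), gammaFunctional_laguerrePoly_mul_of_lt hβ h, smul_zero]
  · exact fun h => absurd hp h

lemma laguerreL_eq_eval (α k : ℕ) {τ : ℝ} (hτ : 0 < τ) :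
    laguerreL k α τ = (laguerrePoly α k).eval τ := by
  have hfun : (fun s : ℝ => Real.exp (-s) * s ^ ((k : ℝ) + α)) =
      fun s : ℝ => Real.exp (-1 * s) * s ^ (k + α) := by
    ext s
    rw [← Nat.cast_add, Real.rpow_natCast, neg_one_mul]
  rw [laguerreL, hfun, iteratedDeriv_fun_mul (by fun_prop) (by fun_prop), laguerrePoly,
    Polynomial.eval_finsetSum, Finset.mul_sum]
  refine Finset.sum_congr rfl fun i hi => ?_
  have hij : i ≤ k := Nat.lt_succ_iff.1 (Finset.mem_range.1 hi)
  obtain ⟨l, rfl⟩ := Nat.exists_eq_add_of_le hij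
  have h1 : (ascPochhammer ℝ l).eval ((α : ℝ) + i + 1) =
      (((i + l + α).descFactorial l : ℕ) : ℝ) := by
    rw [show i + l + α = α + i + 1 + l - 1 by omega, ← ascPochhammer_nat_eq_natCast_descFactorial]
    push_cast; rfl
  have h2 : τ ^ (-(α : ℝ)) = (τ ^ α)⁻¹ := by rw [Real.rpow_neg hτ.le, Real.rpow_natCast]
  have h3 : Real.exp (-1 * τ) = (Real.exp τ)⁻¹ := by rw [neg_one_mul, Real.exp_neg]
  simp only [iteratedDeriv_exp_const_mul]
  rw [iteratedDeriv_pow, Polynomial.eval_monomial, risingBinom,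
    add_tsub_cancel_left, h1, h2, h3, Nat.cast_choose ℝ hij, add_tsub_cancel_left,
    show i + l + α - l = i + α by omega, pow_add]
  have := Real.exp_pos τ
  have : ((i + l).factorial : ℝ) ≠ 0 := by positivity
  field_simp

lemma laguerreNorm_sq_mul_rpow (α k : ℕ) (s : ℝ) {τ : ℝ} (hτ : 0 < τ) :
    laguerreNorm k α τ ^ 2 * τ ^ (-s) =
      ((k.factorial : ℝ) / (k + α).factorial) *
        ((laguerrePoly α k * laguerrePoly α k).eval τ * (τ ^ (α - s) * Real.exp (-τ))) := by
  rw [laguerreNorm, laguerreL_eq_eval α k hτ, Polynomial.eval_mul, ← Nat.cast_add,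
    Real.Gamma_nat_eq_factorial, Real.Gamma_nat_eq_factorial, sub_eq_add_neg, Real.rpow_add hτ]
  have h1 : Real.exp (-τ / 2) ^ 2 = Real.exp (-τ) := by
    rw [← Real.exp_nat_mul]; congr 1; push_cast; ring
  have h2 : (τ ^ ((α : ℝ) / 2)) ^ 2 = τ ^ (α : ℝ) := by
    rw [← Real.rpow_natCast, ← Real.rpow_mul hτ.le]; congr 1; push_cast; ring
  rw [mul_pow, mul_pow, mul_pow, Real.sq_sqrt (by positivity), h1, h2]
  ring

lemma lintegral_laguerreNorm_sq_mul_rpow (α k : ℕ) {s : ℝ} (hs : -1 < α - s) :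
    ∫⁻ τ in Set.Ioi 0, ENNReal.ofReal (laguerreNorm k α τ ^ 2 * τ ^ (-s)) =
      ENNReal.ofReal (((k.factorial : ℝ) / (k + α).factorial) *
        gammaFunctional (α - s) (laguerrePoly α k * laguerrePoly α k)) := by
  obtain ⟨hi, he⟩ := integral_eval_mul hs (laguerrePoly α k * laguerrePoly α k)
  rw [← he, ← integral_const_mul, ofReal_integral_eq_lintegral_ofReal (hi.const_mul _)]
  · exact setLIntegral_congr_fun measurableSet_Ioi fun τ hτ => by
      rw [laguerreNorm_sq_mul_rpow α k s hτ]
  · filter_upwards [ae_restrict_mem measurableSet_Ioi] with τ hτ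
    have hτ : 0 < τ := hτ
    rw [← laguerreNorm_sq_mul_rpow α k s hτ]
    positivity

lemma mul_rpow_neg_half_le (f s : ℝ) {A τ : ℝ} (hA : 0 < A) (hτ : 0 < τ) :
    |f| * τ ^ (-(1 : ℝ) / 2) ≤ A * (f ^ 2 * τ ^ (-s)) + A⁻¹ * τ ^ (s - 1) := by
  have h1 : τ ^ (-(1 : ℝ) / 2) = τ ^ (-s / 2) * τ ^ ((s - 1) / 2) := by
    rw [← Real.rpow_add hτ]; congr 1; ring
  have h2 : τ ^ (-s) = (τ ^ (-s / 2)) ^ 2 := by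
    rw [← Real.rpow_natCast, ← Real.rpow_mul hτ.le]; congr 1; push_cast; ring
  have h3 : τ ^ (s - 1) = (τ ^ ((s - 1) / 2)) ^ 2 := by
    rw [← Real.rpow_natCast, ← Real.rpow_mul hτ.le]; congr 1; push_cast; ring
  rw [h1, h2, h3, ← sq_abs f]
  set u := |f| * τ ^ (-s / 2)
  set v := τ ^ ((s - 1) / 2)
  have hu : 0 ≤ u := by positivity
  have hv : 0 ≤ v := by positivity
  have hsq : 0 ≤ A⁻¹ * (A * u - v) ^ 2 := by positivity
  have hAA : A⁻¹ * (A * u - v) ^ 2 = A * u ^ 2 - 2 * (u * v) + A⁻¹ * v ^ 2 := by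
    field_simp
    ring
  have : 0 ≤ u * v := mul_nonneg hu hv
  rw [← mul_assoc, ← mul_pow]
  linarith

lemma setLIntegral_laguerreNorm_le (α k : ℕ) {s A : ℝ} (hs : -1 < α - s) (hA : 0 < A)
    {S : Set ℝ} (hS : S ⊆ Set.Ioi 0) (hSm : MeasurableSet S)
    (hi : IntegrableOn (fun τ : ℝ => τ ^ (s - 1)) S) :
    ∫⁻ τ in S, ENNReal.ofReal (|laguerreNorm k α τ| * τ ^ (-(1 : ℝ) / 2)) ≤
      ENNReal.ofReal (A * (((k.factorial : ℝ) / (k + α).factorial) *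
        gammaFunctional (α - s) (laguerrePoly α k * laguerrePoly α k))) +
      ENNReal.ofReal (A⁻¹ * ∫ τ in S, τ ^ (s - 1)) := by
  calc ∫⁻ τ in S, ENNReal.ofReal (|laguerreNorm k α τ| * τ ^ (-(1 : ℝ) / 2))
      ≤ ∫⁻ τ in S, (ENNReal.ofReal A * ENNReal.ofReal (laguerreNorm k α τ ^ 2 * τ ^ (-s)) +
          ENNReal.ofReal (A⁻¹ * τ ^ (s - 1))) := by
        refine setLIntegral_mono' hSm fun τ hτ => ?_
        have hτ : 0 < τ := hS hτ
        rw [← ENNReal.ofReal_mul hA.le, ← ENNReal.ofReal_add (by positivity) (by positivity)]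
        exact ENNReal.ofReal_le_ofReal (mul_rpow_neg_half_le _ s hA hτ)
    _ = ENNReal.ofReal A * (∫⁻ τ in S, ENNReal.ofReal (laguerreNorm k α τ ^ 2 * τ ^ (-s))) +
          ENNReal.ofReal (A⁻¹ * ∫ τ in S, τ ^ (s - 1)) := by
        rw [lintegral_add_right _ (by fun_prop), lintegral_const_mul' _ _ ENNReal.ofReal_ne_top,
          ← integral_const_mul, ofReal_integral_eq_lintegral_ofReal (hi.const_mul _)]
        filter_upwards [ae_restrict_mem hSm] with τ hτ
        have hτ : 0 < τ := hS hτ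
        positivity
    _ ≤ _ := by
        gcongr
        rw [ENNReal.ofReal_mul hA.le, ← lintegral_laguerreNorm_sq_mul_rpow α k hs]
        gcongr

lemma factorial_ratio_le (α : ℕ) {j k : ℕ} (h : j ≤ k) :
    ((k.factorial : ℝ) / (k + α).factorial) * ((j + α).factorial / j.factorial) ≤ 1 := by
  have h1 : ((k + α).choose α : ℝ) * k.factorial * α.factorial = (k + α).factorial := by
    exact_mod_cast Nat.add_choose_mul_factorial_mul_factorial k α
  have h2 : ((j + α).choose α : ℝ) * j.factorial * α.factorial = (j + α).factorial := by
    exact_mod_cast Nat.add_choose_mul_factorial_mul_factorial j α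
  have h3 : ((j + α).choose α : ℝ) ≤ (k + α).choose α := by
    exact_mod_cast Nat.choose_le_choose α (by omega)
  have h4 : (0 : ℝ) < (k + α).choose α := by exact_mod_cast Nat.choose_pos (by omega)
  rw [← h1, ← h2]
  have : (k.factorial : ℝ) ≠ 0 := by positivity
  have : (j.factorial : ℝ) ≠ 0 := by positivity
  have : (α.factorial : ℝ) ≠ 0 := by positivity
  calc _ = ((j + α).choose α : ℝ) / (k + α).choose α := by field_simp
    _ ≤ 1 := (div_le_one h4).2 h3

/-- The weighted `L²` bound carrying the bulk of the estimate. -/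
lemma exists_gammaFunctional_laguerrePoly_sq_le (α : ℕ) : ∃ C > (0 : ℝ), ∀ k : ℕ,
    ((k.factorial : ℝ) / (k + α).factorial) *
      gammaFunctional (α - 1 / 4) (laguerrePoly α k * laguerrePoly α k) ≤
        C * ((k : ℝ) + 1) ^ (-(1 : ℝ) / 4) := by
  have hsum : Summable fun n : ℕ => ((n : ℝ) + 1) ^ (-(5 : ℝ) / 4) := by
    simpa using (summable_nat_add_iff 1).2
      (Real.summable_nat_rpow (p := -(5 : ℝ) / 4).2 (by norm_num))
  have hΓ : 0 < Real.Gamma (3 / 4) := Real.Gamma_pos_of_pos (by norm_num)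
  have hT : 0 < ∑' n : ℕ, ((n : ℝ) + 1) ^ (-(5 : ℝ) / 4) :=
    hsum.tsum_pos (fun n => by positivity) 0 (by positivity)
  refine ⟨Real.Gamma (3 / 4) * ∑' n : ℕ, ((n : ℝ) + 1) ^ (-(5 : ℝ) / 4), by positivity,
    fun k => ?_⟩
  have hα : (0 : ℝ) ≤ α := by positivity
  have hconn := gammaFunctional_laguerrePoly_add_sq (β := (α : ℝ) - 1 / 4) (by linarith) (1 / 4) k
  rw [sub_add_cancel] at hconn
  rw [hconn, Finset.mul_sum]
  have hterm : ∀ p ∈ Finset.HasAntidiagonal.antidiagonal k,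
      ((k.factorial : ℝ) / (k + α).factorial) *
        (risingBinom (1 / 4) p.1 ^ 2 * (Real.Gamma (p.2 + (α - 1 / 4) + 1) / p.2.factorial)) ≤
      Real.Gamma (3 / 4) * ((k : ℝ) + 1) ^ (-(1 : ℝ) / 4) * ((p.1 : ℝ) + 1) ^ (-(5 : ℝ) / 4) := by
    rintro ⟨i, j⟩ hp
    have hij : i + j = k := Finset.HasAntidiagonal.mem_antidiagonal.1 hp
    have h1 : risingBinom (1 / 4) i ^ 2 ≤ ((i : ℝ) + 1) ^ (-(3 : ℝ) / 2) := by
      have h := risingBinom_le (t := 1 / 4) (by norm_num) (by norm_num) i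
      calc _ ≤ (((i : ℝ) + 1) ^ ((1 : ℝ) / 4 - 1)) ^ 2 :=
            pow_le_pow_left₀ (risingBinom_nonneg (by norm_num) i) h 2
        _ = _ := by
            rw [← Real.rpow_natCast, ← Real.rpow_mul (by positivity)]; norm_num
    have h2 : Real.Gamma (j + (α - 1 / 4) + 1) ≤
        Real.Gamma (3 / 4) * (j + α).factorial * ((j : ℝ) + 1) ^ (-(1 : ℝ) / 4) := by
      have hg := Gamma_add_nat (t := 3 / 4) (by norm_num) (j + α)
      have hb := risingBinom_le (t := 3 / 4) (by norm_num) (by norm_num) (j + α)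
      have hmono : (((j + α : ℕ) : ℝ) + 1) ^ ((3 : ℝ) / 4 - 1) ≤ ((j : ℝ) + 1) ^ (-(1 : ℝ) / 4) := by
        rw [show (3 : ℝ) / 4 - 1 = -1 / 4 by norm_num]
        exact Real.rpow_le_rpow_of_nonpos (by positivity) (by push_cast; linarith) (by norm_num)
      rw [risingBinom, div_le_iff₀ (by positivity)] at hb
      rw [show (j : ℝ) + (α - 1 / 4) + 1 = 3 / 4 + ((j + α : ℕ) : ℝ) by push_cast; ring, hg,
        mul_assoc]
      refine mul_le_mul_of_nonneg_left (hb.trans ?_) hΓ.le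
      rw [mul_comm]
      exact mul_le_mul_of_nonneg_left hmono (by positivity)
    have h3 : ((i : ℝ) + 1) ^ (-(3 : ℝ) / 2) * ((j : ℝ) + 1) ^ (-(1 : ℝ) / 4) ≤
        ((k : ℝ) + 1) ^ (-(1 : ℝ) / 4) * ((i : ℝ) + 1) ^ (-(5 : ℝ) / 4) := by
      rw [show -(3 : ℝ) / 2 = -5 / 4 + -1 / 4 by norm_num, Real.rpow_add (by positivity), mul_assoc,
        ← Real.mul_rpow (by positivity) (by positivity), mul_comm]
      refine mul_le_mul_of_nonneg_right ?_ (by positivity)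
      refine Real.rpow_le_rpow_of_nonpos (by positivity) ?_ (by norm_num)
      rw [← hij]
      push_cast
      have : (0 : ℝ) ≤ i * j := by positivity
      linarith
    calc ((k.factorial : ℝ) / (k + α).factorial) *
          (risingBinom (1 / 4) i ^ 2 * (Real.Gamma (j + (α - 1 / 4) + 1) / j.factorial))
        ≤ ((k.factorial : ℝ) / (k + α).factorial) * (((i : ℝ) + 1) ^ (-(3 : ℝ) / 2) *
          ((Real.Gamma (3 / 4) * (j + α).factorial * ((j : ℝ) + 1) ^ (-(1 : ℝ) / 4)) /
            j.factorial)) := by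
          have hpos : 0 < (j : ℝ) + (α - 1 / 4) + 1 := by
            have : (0 : ℝ) ≤ j := by positivity
            linarith
          have := Real.Gamma_pos_of_pos hpos
          gcongr
      _ = (((k.factorial : ℝ) / (k + α).factorial) * ((j + α).factorial / j.factorial)) *
          (Real.Gamma (3 / 4) *
            (((i : ℝ) + 1) ^ (-(3 : ℝ) / 2) * ((j : ℝ) + 1) ^ (-(1 : ℝ) / 4))) := by ring
      _ ≤ 1 * (Real.Gamma (3 / 4) *
            (((k : ℝ) + 1) ^ (-(1 : ℝ) / 4) * ((i : ℝ) + 1) ^ (-(5 : ℝ) / 4))) := by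
          gcongr
          exact factorial_ratio_le α (by omega)
      _ = _ := by ring
  refine (Finset.sum_le_sum hterm).trans ?_
  rw [← Finset.mul_sum, mul_right_comm]
  refine mul_le_mul_of_nonneg_right (mul_le_mul_of_nonneg_left ?_ hΓ.le) (by positivity)
  rw [Finset.Nat.sum_antidiagonal_eq_sum_range_succ_mk]
  exact hsum.sum_le_tsum _ fun n _ => by positivity

lemma risingBinom_neg_one (n : ℕ) : risingBinom (-1) (n + 2) = 0 := by
  rw [risingBinom, show (-1 : ℝ) = -((1 : ℕ) : ℝ) by simp,
    ascPochhammer_eval_neg_coe_nat_of_lt (by omega), zero_div]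

/-- The first moment of the square of the normalized Laguerre function. -/
lemma gammaFunctional_add_one_laguerrePoly_sq (α k : ℕ) :
    ((k.factorial : ℝ) / (k + α).factorial) *
      gammaFunctional (α - -1) (laguerrePoly α k * laguerrePoly α k) = 2 * k + α + 1 := by
  have hα : (0 : ℝ) ≤ α := by positivity
  have hconn := gammaFunctional_laguerrePoly_add_sq (β := (α : ℝ) - -1) (by linarith) (-1) k
  rw [sub_add_cancel] at hconn
  rw [hconn, Finset.Nat.sum_antidiagonal_eq_sum_range_succ_mk]
  have hΓ : ∀ j : ℕ, Real.Gamma (j + (α - -1) + 1) = (j + α + 1).factorial := fun j => by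
    rw [← Real.Gamma_nat_eq_factorial]; congr 1; push_cast; ring
  simp only [hΓ]
  have h1 : risingBinom (-1) 1 = -1 := by simp [risingBinom]
  rcases k with _ | k
  · have : (α.factorial : ℝ) ≠ 0 := by positivity
    simp [risingBinom_zero, Nat.factorial_succ]
    field_simp
  · rw [Finset.sum_range_succ', Finset.sum_range_succ', Finset.sum_eq_zero]
    · have h2 : ((k + 1 + α).factorial : ℝ) = (k + α + 1).factorial := by
        rw [show k + 1 + α = k + α + 1 by ring]
      have h3 : ((k + 1 + α + 1).factorial : ℝ) = (k + α + 2) * (k + α + 1).factorial := by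
        rw [show k + 1 + α + 1 = (k + α + 1) + 1 by ring, Nat.factorial_succ (k + α + 1)]
        push_cast; ring
      have : ((k + α + 1).factorial : ℝ) ≠ 0 := by positivity
      have : (k.factorial : ℝ) ≠ 0 := by positivity
      simp only [zero_add, Nat.sub_zero, risingBinom_zero, h1, h2, h3, add_tsub_cancel_right]
      rw [Nat.factorial_succ k]
      push_cast
      field_simp
      ring
    · intro i _
      simp only [add_assoc, Nat.reduceAdd, risingBinom_neg_one]
      simp

theorem laguerre_L1_bound (d₁ : ℕ) (hd₁ : 1 ≤ d₁) :
    ∃ C > (0 : ℝ), ∀ k : ℕ,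
      (∫⁻ τ in Set.Ioi (0 : ℝ),
        ENNReal.ofReal (|laguerreNorm k ((d₁ : ℝ) - 1) τ| * τ ^ (-(1 : ℝ) / 2))) ≤
        ENNReal.ofReal C := by
  obtain ⟨α, rfl⟩ := Nat.exists_eq_add_of_le' hd₁
  obtain ⟨C, hC, hCk⟩ := exists_gammaFunctional_laguerrePoly_sq_le α
  refine ⟨C + 4 + (α + 2) + 1, by positivity, fun k => ?_⟩
  rw [show ((α + 1 : ℕ) : ℝ) - 1 = α by simp]
  have hα : (0 : ℝ) ≤ α := by positivity
  have hK : (0 : ℝ) < k + 1 := by positivity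
  have hlow : ∫⁻ τ in Set.Ioc 0 ((k : ℝ) + 1),
      ENNReal.ofReal (|laguerreNorm k α τ| * τ ^ (-(1 : ℝ) / 2)) ≤
        ENNReal.ofReal C + ENNReal.ofReal 4 := by
    refine (setLIntegral_laguerreNorm_le α k (s := 1 / 4) (A := ((k : ℝ) + 1) ^ ((1 : ℝ) / 4))
      (by linarith) (by positivity) (fun x hx => hx.1) measurableSet_Ioc ?_).trans ?_
    · rw [← intervalIntegrable_iff_integrableOn_Ioc_of_le hK.le]
      exact intervalIntegral.intervalIntegrable_rpow' (by norm_num)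
    · gcongr
      · calc _ ≤ ((k : ℝ) + 1) ^ ((1 : ℝ) / 4) * (C * ((k : ℝ) + 1) ^ (-(1 : ℝ) / 4)) := by
              exact mul_le_mul_of_nonneg_left (hCk k) (by positivity)
          _ = C * (((k : ℝ) + 1) ^ ((1 : ℝ) / 4) * ((k : ℝ) + 1) ^ (-(1 : ℝ) / 4)) := by ring
          _ = C := by rw [← Real.rpow_add hK]; norm_num
      · rw [← intervalIntegral.integral_of_le hK.le, integral_rpow (by left; norm_num),
          show (1 : ℝ) / 4 - 1 + 1 = 1 / 4 by norm_num, Real.zero_rpow (by norm_num), sub_zero]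
        have : ((k : ℝ) + 1) ^ ((1 : ℝ) / 4) ≠ 0 := by positivity
        field_simp
        norm_num
  have hhigh : ∫⁻ τ in Set.Ioi ((k : ℝ) + 1),
      ENNReal.ofReal (|laguerreNorm k α τ| * τ ^ (-(1 : ℝ) / 2)) ≤
        ENNReal.ofReal (α + 2) + ENNReal.ofReal 1 := by
    refine (setLIntegral_laguerreNorm_le α k (s := -1) (A := ((k : ℝ) + 1)⁻¹)
      (by linarith) (by positivity) (Set.Ioi_subset_Ioi hK.le) measurableSet_Ioi
      (integrableOn_Ioi_rpow_of_lt (by norm_num) hK)).trans ?_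
    gcongr
    · rw [gammaFunctional_add_one_laguerrePoly_sq, inv_mul_le_iff₀ hK]
      have : (0 : ℝ) ≤ k * α := by positivity
      linarith
    · rw [integral_Ioi_rpow_of_lt (by norm_num) hK, show (-1 : ℝ) - 1 + 1 = -1 by norm_num,
        Real.rpow_neg_one]
      field_simp
      norm_num
  rw [← Set.Ioc_union_Ioi_eq_Ioi hK.le,
    lintegral_union measurableSet_Ioi Set.Ioc_disjoint_Ioi_same,
    ENNReal.ofReal_add (by positivity) (by positivity),
    ENNReal.ofReal_add (by positivity) (by positivity), ENNReal.ofReal_add hC.le (by positivity),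
    add_assoc (_ + _)]
  exact add_le_add hlow hhigh
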